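/- Let p be an odd prime and G = H₃(ℤ/p²ℤ). For every 2-cocycle α of G with values in ℂˣ there exist λ₁, λ₂ ∈ ℂˣ with λ₁^{p²} = λ₂^{p²} = 1 such that α is cohomologous to the 2-cocycle α' given by α'(g(a,b,c), g(a',b',c')) = λ₁^{c'a + b·C(a') + aba'} · λ₂^{c'b + a'·C(b)}. -/

import Mathlib

/-- The Heisenberg group `H₃(R)` of 3×3 upper unitriangular matrices over a commutative
ring `R`.  An element is determined by its entries: `b` is the (1,2)-entry, `a` is the
(2,3)-entry and `c` is the (1,3)-entry; multiplication is matrix multiplication. -/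
@[ext]
structure Heisenberg (R : Type*) [CommRing R] where
  a : R
  b : R
  c : R

namespace Heisenberg

variable {R : Type*} [CommRing R]

instance : Mul (Heisenberg R) :=
  ⟨fun x y => ⟨x.a + y.a, x.b + y.b, x.c + y.c + x.b * y.a⟩⟩

instance : One (Heisenberg R) := ⟨⟨0, 0, 0⟩⟩

instance : Inv (Heisenberg R) := ⟨fun x => ⟨-x.a, -x.b, -x.c + x.b * x.a⟩⟩

@[simp] lemma mul_a (x y : Heisenberg R) : (x * y).a = x.a + y.a := rfl
@[simp] lemma mul_b (x y : Heisenberg R) : (x * y).b = x.b + y.b := rfl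
@[simp] lemma mul_c (x y : Heisenberg R) : (x * y).c = x.c + y.c + x.b * y.a := rfl
@[simp] lemma one_a : (1 : Heisenberg R).a = 0 := rfl
@[simp] lemma one_b : (1 : Heisenberg R).b = 0 := rfl
@[simp] lemma one_c : (1 : Heisenberg R).c = 0 := rfl
@[simp] lemma inv_a (x : Heisenberg R) : x⁻¹.a = -x.a := rfl
@[simp] lemma inv_b (x : Heisenberg R) : x⁻¹.b = -x.b := rfl
@[simp] lemma inv_c (x : Heisenberg R) : x⁻¹.c = -x.c + x.b * x.a := rfl

/-- Matrix multiplication of unitriangular matrices makes `H₃(R)` a group. -/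
instance : Group (Heisenberg R) where
  mul := (· * ·)
  one := 1
  inv := (·⁻¹)
  mul_assoc x y z := by ext <;> simp only [mul_a, mul_b, mul_c] <;> ring
  one_mul x := by ext <;> simp only [mul_a, mul_b, mul_c, one_a, one_b, one_c] <;> ring
  mul_one x := by ext <;> simp only [mul_a, mul_b, mul_c, one_a, one_b, one_c] <;> ring
  inv_mul_cancel x := by
    ext <;> simp only [mul_a, mul_b, mul_c, inv_a, inv_b, inv_c, one_a, one_b, one_c] <;> ring

end Heisenberg

section Cocycles

variable {G : Type*} [Group G]

/-- A (normalized) `2`-cocycle of `G` with values in `ℂˣ` (trivial action):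
`α(1,1) = 1` and `α(x,y)α(xy,z) = α(x,yz)α(y,z)`. -/
def IsMul2Cocycle (α : G × G → ℂˣ) : Prop :=
  α (1, 1) = 1 ∧ ∀ x y z : G, α (x, y) * α (x * y, z) = α (x, y * z) * α (y, z)

/-- Two `2`-cocycles `α, α'` are cohomologous if they differ by a `2`-coboundary:
`α'(x,y) = f(x)f(y)f(xy)⁻¹α(x,y)` for some `f : G → ℂˣ` with `f 1 = 1`. -/
def IsCohomologous (α α' : G × G → ℂˣ) : Prop :=
  ∃ f : G → ℂˣ, f 1 = 1 ∧ ∀ x y : G, α' (x, y) = f x * f y * (f (x * y))⁻¹ * α (x, y)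

end Cocycles

/-- `C(x) = x(x-1)/2` (2 is invertible in `ZMod n` for odd `n`). -/
def Cb {n : ℕ} (x : ZMod n) : ZMod n := x * (x - 1) * (2 : ZMod n)⁻¹

/-- The central extension of `G` by `ℂˣ` attached to a `2`-cocycle `α`. -/
@[ext]
structure CocycleExtension {G : Type*} [Group G] (α : G × G → ℂˣ) (hα : IsMul2Cocycle α) where
  scalar : ℂˣ
  proj : G

lemma IsMul2Cocycle.one_left {G : Type*} [Group G] {α : G × G → ℂˣ} (hα : IsMul2Cocycle α)
    (g : G) : α (1, g) = 1 := by
  have h := hα.2 1 1 g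
  rw [hα.1] at h
  simpa using h

lemma IsMul2Cocycle.one_right {G : Type*} [Group G] {α : G × G → ℂˣ} (hα : IsMul2Cocycle α)
    (g : G) : α (g, 1) = 1 := by
  have h := hα.2 g 1 1
  rw [hα.1] at h
  simpa using h

namespace CocycleExtension

variable {G : Type*} [Group G] {α : G × G → ℂˣ} {hα : IsMul2Cocycle α}

instance : Mul (CocycleExtension α hα) :=
  ⟨fun x y => ⟨x.scalar * y.scalar * α (x.proj, y.proj), x.proj * y.proj⟩⟩

instance : One (CocycleExtension α hα) := ⟨⟨1, 1⟩⟩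

instance : Inv (CocycleExtension α hα) :=
  ⟨fun x => ⟨x.scalar⁻¹ * (α (x.proj⁻¹, x.proj))⁻¹, x.proj⁻¹⟩⟩

@[simp] lemma mul_scalar (x y : CocycleExtension α hα) :
    (x * y).scalar = x.scalar * y.scalar * α (x.proj, y.proj) := rfl
@[simp] lemma mul_proj (x y : CocycleExtension α hα) : (x * y).proj = x.proj * y.proj := rfl
@[simp] lemma one_scalar : (1 : CocycleExtension α hα).scalar = 1 := rfl
@[simp] lemma one_proj : (1 : CocycleExtension α hα).proj = 1 := rfl

instance : Group (CocycleExtension α hα) :=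
  Group.ofLeftAxioms
    (fun x y z => by
      ext1
      · have h := hα.2 x.proj y.proj z.proj
        calc (x * y * z).scalar
            = x.scalar * y.scalar * z.scalar *
                (α (x.proj, y.proj) * α (x.proj * y.proj, z.proj)) := by
              simp only [mul_scalar, mul_proj]
              ac_rfl
          _ = (x * (y * z)).scalar := by
              rw [h]
              simp only [mul_scalar, mul_proj]
              ac_rfl
      · exact mul_assoc _ _ _)
    (fun x => by
      ext1
      · simp [hα.one_left]
      · exact one_mul _)
    (fun x => by
      ext1
      · change x.scalar⁻¹ * (α (x.proj⁻¹, x.proj))⁻¹ * x.scalar * α (x.proj⁻¹, x.proj) = 1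
        rw [mul_right_comm x.scalar⁻¹]
        simp
      · exact inv_mul_cancel _)

/-- The projection of the extension onto the base group. -/
def projHom (hα : IsMul2Cocycle α) : CocycleExtension α hα →* G where
  toFun := proj
  map_one' := rfl
  map_mul' _ _ := rfl

@[simp] lemma projHom_apply (x : CocycleExtension α hα) : projHom hα x = x.proj := rfl

/-- The inclusion of the central subgroup `ℂˣ`. -/
def scalarHom (hα : IsMul2Cocycle α) : ℂˣ →* CocycleExtension α hα where
  toFun t := ⟨t, 1⟩
  map_one' := rfl
  map_mul' s t := by ext1 <;> simp [hα.1]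

@[simp] lemma scalarHom_scalar (t : ℂˣ) : (scalarHom hα t).scalar = t := rfl
@[simp] lemma scalarHom_proj (t : ℂˣ) : (scalarHom hα t).proj = 1 := rfl

lemma scalarHom_injective : Function.Injective (scalarHom hα) :=
  fun _ _ h => congrArg scalar h

lemma scalarHom_commute (t : ℂˣ) (x : CocycleExtension α hα) : Commute (scalarHom hα t) x := by
  ext1
  · simp [hα.one_left, hα.one_right, mul_comm]
  · simp

lemma exists_scalarHom_of_proj_eq_one {x : CocycleExtension α hα} (hx : x.proj = 1) :
    ∃ t, x = scalarHom hα t :=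
  ⟨x.scalar, by ext1 <;> simp [hx]⟩

/-- Since `ℂˣ` is divisible, elements of finite order lift to elements of the same exponent. -/
lemma exists_lift_pow_eq_one (hα : IsMul2Cocycle α) {g : G} {n : ℕ} (hn : n ≠ 0)
    (hg : g ^ n = 1) : ∃ x : CocycleExtension α hα, x.proj = g ∧ x ^ n = 1 := by
  let y : CocycleExtension α hα := ⟨1, g⟩
  have hy : (y ^ n).proj = 1 := by
    rw [← projHom_apply, map_pow]
    exact hg
  obtain ⟨u, hu⟩ := exists_scalarHom_of_proj_eq_one hy
  obtain ⟨t, ht⟩ := IsAlgClosed.exists_pow_nat_eq ((u⁻¹ : ℂˣ) : ℂ) (Nat.pos_of_ne_zero hn)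
  have ht0 : t ≠ 0 := by
    rintro rfl
    rw [zero_pow hn] at ht
    exact (u⁻¹).ne_zero ht.symm
  refine ⟨scalarHom hα (Units.mk0 t ht0) * y, by simp [y], ?_⟩
  have ht' : Units.mk0 t ht0 ^ n = u⁻¹ := by
    ext
    simpa using ht
  rw [(scalarHom_commute _ _).mul_pow, ← map_pow, ht', hu, ← map_mul]
  simp

end CocycleExtension

section CommutatorCalculus

variable {E : Type*} [Group E] {x y z k l : E}

lemma pow_mul_pow_of_mul_eq (hk : ∀ w, Commute k w) (h : x * z = k * (z * x)) (a c : ℕ) :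
    x ^ a * z ^ c = k ^ (a * c) * (z ^ c * x ^ a) := by
  have h1 : ∀ c : ℕ, x * z ^ c = k ^ c * (z ^ c * x) := by
    intro c
    induction c with
    | zero => simp
    | succ c ih =>
      calc x * z ^ (c + 1) = x * z ^ c * z := by rw [pow_succ, mul_assoc]
        _ = k ^ c * z ^ c * (x * z) := by rw [ih]; group
        _ = k ^ c * (z ^ c * k) * (z * x) := by rw [h]; group
        _ = k ^ (c + 1) * (z ^ (c + 1) * x) := by rw [← (hk (z ^ c)).eq]; group
  induction a with
  | zero => simp
  | succ a ih =>
    calc x ^ (a + 1) * z ^ c = x ^ a * (x * z ^ c) := by rw [pow_succ, mul_assoc]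
      _ = (x ^ a * k ^ c) * (z ^ c * x) := by rw [h1, mul_assoc]
      _ = k ^ c * (x ^ a * z ^ c) * x := by rw [← ((hk (x ^ a)).pow_left c).eq]; group
      _ = k ^ c * k ^ (a * c) * (z ^ c * (x ^ a * x)) := by rw [ih]; group
      _ = _ := by rw [← pow_add, ← pow_succ]; congr 2; ring

lemma pow_mul_pow_eq_of_class_three (hk : ∀ w, Commute k w) (hl : ∀ w, Commute l w)
    (hyx : y * x = z * (x * y)) (hxz : x * z = k * (z * x)) (hyz : y * z = l * (z * y))
    (a b : ℕ) :
    y ^ b * x ^ a = k ^ (b * a.choose 2) * l ^ (a * b.choose 2) *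
      (z ^ (b * a) * x ^ a * y ^ b) := by
  have h1 : ∀ a : ℕ, y * x ^ a = k ^ a.choose 2 * (z ^ a * x ^ a * y) := by
    intro a
    induction a with
    | zero => simp
    | succ a ih =>
      have hxz' := pow_mul_pow_of_mul_eq hk hxz a 1
      rw [pow_one, mul_one] at hxz'
      calc y * x ^ (a + 1) = y * x ^ a * x := by rw [pow_succ, mul_assoc]
        _ = k ^ a.choose 2 * (z ^ a * x ^ a * (y * x)) := by rw [ih]; simp only [mul_assoc]
        _ = k ^ a.choose 2 * (z ^ a * (x ^ a * z) * (x * y)) := by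
          rw [hyx]; simp only [mul_assoc]
        _ = k ^ a.choose 2 * ((z ^ a * k ^ a) * (z * x ^ a) * (x * y)) := by
          rw [hxz']; simp only [mul_assoc]
        _ = (k ^ a.choose 2 * k ^ a) * (z ^ a * z * (x ^ a * x) * y) := by
          rw [← ((hk (z ^ a)).pow_left a).eq]; simp only [mul_assoc]
        _ = _ := by
          rw [← pow_add, ← pow_succ, ← pow_succ]
          congr 2
          rw [Nat.choose_succ_succ' a 1, Nat.choose_one_right, add_comm]
  induction b with
  | zero => simp
  | succ b ih =>
    have hyz' := pow_mul_pow_of_mul_eq hl hyz b a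
    calc y ^ (b + 1) * x ^ a = y ^ b * (y * x ^ a) := by rw [pow_succ, mul_assoc]
      _ = (y ^ b * k ^ a.choose 2) * (z ^ a * x ^ a * y) := by
        rw [h1]; simp only [mul_assoc]
      _ = k ^ a.choose 2 * (y ^ b * z ^ a) * x ^ a * y := by
        rw [← ((hk (y ^ b)).pow_left _).eq]; simp only [mul_assoc]
      _ = k ^ a.choose 2 * l ^ (b * a) * z ^ a * (y ^ b * x ^ a) * y := by
        rw [hyz']; simp only [mul_assoc]
      _ = k ^ a.choose 2 * l ^ (b * a) * (z ^ a * (k ^ (b * a.choose 2) * l ^ (a * b.choose 2))) *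
            (z ^ (b * a) * x ^ a * y ^ b) * y := by
        rw [ih]; simp only [mul_assoc]
      _ = k ^ a.choose 2 * (l ^ (b * a) * k ^ (b * a.choose 2)) * l ^ (a * b.choose 2) *
            ((z ^ a * z ^ (b * a)) * x ^ a * (y ^ b * y)) := by
        rw [← (((hk (z ^ a)).pow_left _).mul_left ((hl (z ^ a)).pow_left _)).eq]
        simp only [mul_assoc]
      _ = (k ^ a.choose 2 * k ^ (b * a.choose 2)) * (l ^ (b * a) * l ^ (a * b.choose 2)) *
            ((z ^ a * z ^ (b * a)) * x ^ a * (y ^ b * y)) := by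
        rw [← ((hk (l ^ (b * a))).pow_left _).eq]
        simp only [mul_assoc]
      _ = _ := by
        rw [← pow_add, ← pow_add, ← pow_add, ← pow_succ, Nat.choose_succ_succ' b 1,
          Nat.choose_one_right, show (b + 1) * a.choose 2 = a.choose 2 + b * a.choose 2 by ring,
          show (b + 1) * a = a + b * a by ring, mul_add, mul_comm b a]

lemma normal_form_mul (hk : ∀ w, Commute k w) (hl : ∀ w, Commute l w)
    (hyx : y * x = z * (x * y)) (hxz : x * z = k * (z * x)) (hyz : y * z = l * (z * y))
    (a b c a' b' c' : ℕ) :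
    z ^ c * x ^ a * y ^ b * (z ^ c' * x ^ a' * y ^ b') =
      k ^ (c' * a + b * a'.choose 2 + a * b * a') * l ^ (c' * b + a' * b.choose 2) *
        (z ^ (c + c' + b * a') * x ^ (a + a') * y ^ (b + b')) := by
  have hc : ∀ (i j : ℕ) (w : E), Commute (k ^ i * l ^ j) w := fun i j w =>
    ((hk w).pow_left i).mul_left ((hl w).pow_left j)
  calc z ^ c * x ^ a * y ^ b * (z ^ c' * x ^ a' * y ^ b')
      = z ^ c * x ^ a * (y ^ b * z ^ c') * (x ^ a' * y ^ b') := by simp only [mul_assoc]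
    _ = (z ^ c * x ^ a * l ^ (b * c')) * (z ^ c' * (y ^ b * x ^ a') * y ^ b') := by
      rw [pow_mul_pow_of_mul_eq hl hyz]; simp only [mul_assoc]
    _ = l ^ (b * c') * z ^ c * x ^ a *
        (z ^ c' * (k ^ (b * a'.choose 2) * l ^ (a' * b.choose 2))) *
        (z ^ (b * a') * x ^ a' * (y ^ b * y ^ b')) := by
      rw [pow_mul_pow_eq_of_class_three hk hl hyx hxz hyz,
        ← ((hl (z ^ c * x ^ a)).pow_left _).eq]
      simp only [mul_assoc]
    _ = l ^ (b * c') * (z ^ c * x ^ a * (k ^ (b * a'.choose 2) * l ^ (a' * b.choose 2))) *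
        ((z ^ c' * z ^ (b * a')) * x ^ a' * (y ^ b * y ^ b')) := by
      rw [← (hc _ _ (z ^ c')).eq]
      simp only [mul_assoc]
    _ = l ^ (b * c') * (k ^ (b * a'.choose 2) * l ^ (a' * b.choose 2)) * z ^ c *
        (x ^ a * z ^ (c' + b * a')) * x ^ a' * y ^ (b + b') := by
      rw [← (hc _ _ (z ^ c * x ^ a)).eq, ← pow_add, ← pow_add]
      simp only [mul_assoc]
    _ = l ^ (b * c') * (k ^ (b * a'.choose 2) * l ^ (a' * b.choose 2)) *
        (z ^ c * k ^ (a * (c' + b * a'))) *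
        z ^ (c' + b * a') * (x ^ a * x ^ a') * y ^ (b + b') := by
      rw [pow_mul_pow_of_mul_eq hk hxz]
      simp only [mul_assoc]
    _ = (l ^ (b * c') * ((k ^ (b * a'.choose 2) * l ^ (a' * b.choose 2)) *
        k ^ (a * (c' + b * a')))) *
        (z ^ (c + c' + b * a') * x ^ (a + a') * y ^ (b + b')) := by
      rw [← ((hk (z ^ c)).pow_left _).eq, ← pow_add, add_assoc c, pow_add z c]
      simp only [mul_assoc]
    _ = _ := by
      congr 1
      rw [(hc _ _ (k ^ (a * (c' + b * a')))).eq, ← mul_assoc (k ^ (a * (c' + b * a'))),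
        ← pow_add, ← mul_assoc, ← ((hk (l ^ (b * c'))).pow_left _).eq, mul_assoc, ← pow_add]
      congr 2 <;> ring

lemma pow_eq_one_of_class_three {n : ℕ} (hn : Odd n) (hk : ∀ w, Commute k w)
    (hl : ∀ w, Commute l w)
    (hyx : y * x = z * (x * y)) (hxz : x * z = k * (z * x)) (hyz : y * z = l * (z * y))
    (hx : x ^ n = 1) (hy : y ^ n = 1) : k ^ n = 1 ∧ l ^ n = 1 ∧ z ^ n = 1 := by
  have hkn : k ^ n = 1 := by simpa [hx] using pow_mul_pow_of_mul_eq hk hxz n 1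
  have hln : l ^ n = 1 := by simpa [hy] using pow_mul_pow_of_mul_eq hl hyz n 1
  refine ⟨hkn, hln, ?_⟩
  have h := pow_mul_pow_eq_of_class_three hk hl hyx hxz hyz n 1
  obtain ⟨m, rfl⟩ := hn
  have hm : (2 * m + 1).choose 2 = (2 * m + 1) * m := by
    rw [Nat.choose_two_right, Nat.add_sub_cancel, mul_left_comm, Nat.mul_div_cancel_left _ two_pos]
  rw [hx, hm, one_mul, pow_mul, hkn] at h
  simpa using h

end CommutatorCalculus

lemma natCast_choose_two {n : ℕ} (hn : Odd n) (m : ℕ) :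
    ((m.choose 2 : ℕ) : ZMod n) = Cb (m : ZMod n) := by
  have h2 : (2 : ZMod n) * (2 : ZMod n)⁻¹ = 1 := by
    exact_mod_cast ZMod.coe_mul_inv_eq_one 2 (Nat.coprime_two_left.mpr hn)
  induction m with
  | zero => simp [Cb]
  | succ m ih =>
    rw [Nat.choose_succ_succ' m 1, Nat.choose_one_right, Nat.cast_add, ih]
    simp only [Cb]
    push_cast
    linear_combination (-(m : ZMod n)) * h2

lemma pow_eq_pow_val {M : Type*} [Monoid M] {n : ℕ} [NeZero n] {x : M} (hx : x ^ n = 1) {m : ℕ}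
    {r : ZMod n} (h : (m : ZMod n) = r) : x ^ m = x ^ r.val := by
  rw [← h, ZMod.val_natCast, pow_eq_pow_mod m hx]

namespace Heisenberg

variable {R : Type*} [CommRing R]

lemma mk_a_pow (n : ℕ) : (⟨1, 0, 0⟩ : Heisenberg R) ^ n = ⟨n, 0, 0⟩ := by
  induction n with
  | zero => simp; rfl
  | succ n ih => rw [pow_succ, ih]; ext <;> simp

lemma mk_b_pow (n : ℕ) : (⟨0, 1, 0⟩ : Heisenberg R) ^ n = ⟨0, n, 0⟩ := by
  induction n with
  | zero => simp; rfl
  | succ n ih => rw [pow_succ, ih]; ext <;> simp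

lemma mk_c_pow (n : ℕ) : (⟨0, 0, 1⟩ : Heisenberg R) ^ n = ⟨0, 0, n⟩ := by
  induction n with
  | zero => simp; rfl
  | succ n ih => rw [pow_succ, ih]; ext <;> simp

/-- The classification of `2`-cocycles of `H₃(ℤ/nℤ)` for odd `n`. -/
theorem exists_isCohomologous_of_odd {n : ℕ} (hn : Odd n)
    (α : Heisenberg (ZMod n) × Heisenberg (ZMod n) → ℂˣ) (hα : IsMul2Cocycle α) :
    ∃ l₁ l₂ : ℂˣ, l₁ ^ n = 1 ∧ l₂ ^ n = 1 ∧
      IsCohomologous α (fun q =>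
        l₁ ^ ((q.2.c * q.1.a + q.1.b * Cb q.2.a + q.1.a * q.1.b * q.2.a).val) *
        l₂ ^ ((q.2.c * q.1.b + q.2.a * Cb q.1.b).val)) := by
  have hn0 : n ≠ 0 := hn.pos.ne'
  have : NeZero n := ⟨hn0⟩
  obtain ⟨x, hxp, hxn⟩ := CocycleExtension.exists_lift_pow_eq_one hα (g := ⟨1, 0, 0⟩) hn0
    (by rw [mk_a_pow, ZMod.natCast_self]; rfl)
  obtain ⟨y, hyp, hyn⟩ := CocycleExtension.exists_lift_pow_eq_one hα (g := ⟨0, 1, 0⟩) hn0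
    (by rw [mk_b_pow, ZMod.natCast_self]; rfl)
  obtain ⟨z, hz⟩ : ∃ z, z = y * x * (x * y)⁻¹ := ⟨_, rfl⟩
  have hyx : y * x = z * (x * y) := by rw [hz, inv_mul_cancel_right]
  have hzp : z.proj = ⟨0, 0, 1⟩ := by
    have h := congrArg CocycleExtension.proj hyx
    rw [CocycleExtension.mul_proj, CocycleExtension.mul_proj, CocycleExtension.mul_proj,
      hxp, hyp] at h
    rw [← mul_inv_eq_iff_eq_mul] at h
    rw [← h]
    ext <;> simp
  have hcomm : ∀ w : CocycleExtension α hα,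
      ∃ t, w * z = CocycleExtension.scalarHom hα t * (z * w) := by
    intro w
    obtain ⟨t, ht⟩ := CocycleExtension.exists_scalarHom_of_proj_eq_one
      (x := w * z * (z * w)⁻¹) (by
        rw [← CocycleExtension.projHom_apply, map_mul, map_inv, mul_inv_eq_one]
        simp only [CocycleExtension.projHom_apply, CocycleExtension.mul_proj, hzp]
        ext <;> simp [add_comm])
    exact ⟨t, by rw [← ht, inv_mul_cancel_right]⟩
  obtain ⟨l₁, hxz⟩ := hcomm x
  obtain ⟨l₂, hyz⟩ := hcomm y
  have hc₁ := CocycleExtension.scalarHom_commute (hα := hα) l₁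
  have hc₂ := CocycleExtension.scalarHom_commute (hα := hα) l₂
  obtain ⟨h₁, h₂, hzn⟩ := pow_eq_one_of_class_three hn hc₁ hc₂ hyx hxz hyz hxn hyn
  have hl₁ : l₁ ^ n = 1 := CocycleExtension.scalarHom_injective (hα := hα) (by simpa using h₁)
  have hl₂ : l₂ ^ n = 1 := CocycleExtension.scalarHom_injective (hα := hα) (by simpa using h₂)
  let s : Heisenberg (ZMod n) → CocycleExtension α hα := fun g =>
    z ^ g.c.val * x ^ g.a.val * y ^ g.b.val
  have hs : ∀ g, (s g).proj = g := by
    intro g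
    rw [← CocycleExtension.projHom_apply]
    simp only [s, map_mul, map_pow, CocycleExtension.projHom_apply, hxp, hyp, hzp, mk_a_pow,
      mk_b_pow, mk_c_pow, ZMod.natCast_zmod_val]
    ext <;> simp
  have hmul : ∀ g h, s g * s h = CocycleExtension.scalarHom hα
      (l₁ ^ ((h.c * g.a + g.b * Cb h.a + g.a * g.b * h.a).val) *
        l₂ ^ ((h.c * g.b + h.a * Cb g.b).val)) * s (g * h) := by
    intro g h
    simp only [s]
    rw [normal_form_mul hc₁ hc₂ hyx hxz hyz, map_mul, map_pow, map_pow]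
    rw [pow_eq_pow_val h₁ (r := h.c * g.a + g.b * Cb h.a + g.a * g.b * h.a)
        (by simp [natCast_choose_two hn]),
      pow_eq_pow_val h₂ (r := h.c * g.b + h.a * Cb g.b) (by simp [natCast_choose_two hn]),
      pow_eq_pow_val hzn (r := (g * h).c) (by simp),
      pow_eq_pow_val hxn (r := (g * h).a) (by simp),
      pow_eq_pow_val hyn (r := (g * h).b) (by simp)]
  refine ⟨l₁, l₂, hl₁, hl₂, fun g => (s g).scalar, by simp [s], fun g h => ?_⟩
  have key := congrArg CocycleExtension.scalar (hmul g h)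
  simp only [CocycleExtension.mul_scalar, CocycleExtension.scalarHom_scalar,
    CocycleExtension.scalarHom_proj, hs, hα.one_left, mul_one] at key
  rw [mul_right_comm, key, mul_inv_cancel_right]

end Heisenberg

/-- Every `2`-cocycle of `H₃(ℤ/p²ℤ)`, `p` an odd prime, is cohomologous to one of the
standard form determined by scalars `λ₁, λ₂` with `λᵢ^{p²} = 1`.  Here an element of the
group is the unitriangular matrix `g(a,b,c)` with `(1,2)`-entry `b`, `(2,3)`-entry `a`
and `(1,3)`-entry `c`. -/
theorem two_cocycle_classification_heisenberg_zmod_p_sq (p : ℕ) [Fact p.Prime]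
    (hodd : Odd p)
    (α : Heisenberg (ZMod (p ^ 2)) × Heisenberg (ZMod (p ^ 2)) → ℂˣ)
    (hα : IsMul2Cocycle α) :
    ∃ l₁ l₂ : ℂˣ,
      l₁ ^ p ^ 2 = 1 ∧ l₂ ^ p ^ 2 = 1 ∧
      IsCohomologous α (fun q =>
        l₁ ^ ((q.2.c * q.1.a + q.1.b * Cb q.2.a + q.1.a * q.1.b * q.2.a).val) *
        l₂ ^ ((q.2.c * q.1.b + q.2.a * Cb q.1.b).val)) := by
  exact Heisenberg.exists_isCohomologous_of_odd hodd.pow α hα
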